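/- Define the sequence (y_t)_{t ≥ −4} in the polynomial ring R[x] (R = ℤ[a_i, b_i]) by y_{−4} = −x, y_{−3} = y_{−2} = y_{−1} = 1, and y_{t+1} = −y_t^N y_{t−3}/y_{t−2}^N + Σ_{i=1}^d (a_i y_t^{N−k_i} y_{t−1}^{k_i N − 1}/y_{t−2}^{k_i} + b_i y_t^{N−l_i} y_{t−1}^{l_i N − 1}/y_{t−2}^{l_i}), where N = Σ_i (k_i + l_i) and all k_i, l_i are positive even integers. Then y₀ = x + Σ_i (a_i + b_i), and assuming for each t that y_t is a polynomial in x with nonzero constant term and y_{t−1} divides y_t, the same holds for y_{t+1}. -/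

import Mathlib

set_option synthInstance.maxHeartbeats 1000000
set_option maxHeartbeats 1000000

/-- The coefficient ring `R[x] = (ℤ[a_i, b_i])[x]` of the specialized iterates. -/
noncomputable abbrev SpecPoly (d : ℕ) : Type :=
  Polynomial (MvPolynomial (Fin d ⊕ Fin d) ℤ)

/-- Embedding of `R[x]` into its fraction field. -/
noncomputable abbrev specMap (d : ℕ) : SpecPoly d →+* FractionRing (SpecPoly d) :=
  algebraMap (SpecPoly d) (FractionRing (SpecPoly d))

section Confinement

open PowerSeries

/-- The orbit of `r (n + 2) = -r n + S / r (n + 1) ^ k` started at `1, S`. -/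
noncomputable def confinedOrbit {K : Type*} [Field K] (S : K) (k : ℕ) : ℕ → K
  | 0 => 1
  | 1 => S
  | n + 2 => -confinedOrbit S k n + S * ((confinedOrbit S k (n + 1)) ^ k)⁻¹

theorem sq_dvd_of_tau_relation {A ι : Type*} [CommRing A] [IsDomain A] [Fintype ι] {N : ℕ}
    (hN : 4 ≤ N) (k l : ι → ℕ) (hk : ∀ i, 0 < k i) (hl : ∀ i, 0 < l i)
    (hkN : ∀ i, k i + 2 ≤ N) (hlN : ∀ i, l i + 2 ≤ N) (a b : ι → A) {u v w p z : A}
    (hv : v ≠ 0) (hvw : v ^ 2 ∣ w) (hwp : w ^ 2 ∣ p)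
    (h : z * v ^ N = -(p ^ N * u) +
      ∑ i, (a i * p ^ (N - k i) * w ^ (k i * N - 1) * v ^ (N - k i) +
        b i * p ^ (N - l i) * w ^ (l i * N - 1) * v ^ (N - l i))) :
    p ^ 2 ∣ z := by
  have key : ∀ (c : A) (m : ℕ), 0 < m → m + 2 ≤ N →
      p ^ 2 * v ^ N ∣ c * p ^ (N - m) * w ^ (m * N - 1) * v ^ (N - m) := by
    intro c m hm hmN
    have h1 : p ^ 2 ∣ p ^ (N - m) := pow_dvd_pow _ (by omega)
    have h2 : v ^ m ∣ w ^ (m * N - 1) := by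
      have hle : m ≤ m * N - 1 := by
        have : m * 4 ≤ m * N := Nat.mul_le_mul_left _ hN
        omega
      exact (pow_dvd_pow_of_dvd ((dvd_pow_self v two_ne_zero).trans hvw) m).trans
        (pow_dvd_pow _ hle)
    have h3 : v ^ N = v ^ m * v ^ (N - m) := by rw [← pow_add]; congr 1; omega
    rw [h3, ← mul_assoc]
    exact mul_dvd_mul (mul_dvd_mul (h1.mul_left c) h2) dvd_rfl
  have h0 : p ^ 2 * v ^ N ∣ p ^ N * u := by
    have h1 : v ^ N ∣ p ^ (N - 2) := by
      have : v ^ 4 ∣ p := by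
        refine dvd_trans ?_ hwp
        have := pow_dvd_pow_of_dvd hvw 2
        rwa [← pow_mul] at this
      have h2 := pow_dvd_pow_of_dvd this (N - 2)
      rw [← pow_mul] at h2
      exact (pow_dvd_pow _ (by omega)).trans h2
    have h3 : p ^ N = p ^ 2 * p ^ (N - 2) := by rw [← pow_add]; congr 1; omega
    rw [h3]
    exact (mul_dvd_mul_left _ h1).mul_right _
  have : p ^ 2 * v ^ N ∣ z * v ^ N := by
    rw [h]
    refine dvd_add (dvd_neg.2 h0) (Finset.dvd_sum fun i _ ↦ dvd_add ?_ ?_)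
    · exact key _ _ (hk i) (hkN i)
    · exact key _ _ (hl i) (hlN i)
  exact (mul_dvd_mul_iff_right (pow_ne_zero _ hv)).1 this

theorem tau_mul_eq_orbit {K : Type*} [Field K] {S : K} {k N : ℕ} (hk : 0 < k) (hkN : k ≤ N)
    (hS : ∀ n, confinedOrbit S k n ≠ 0) (c : ℕ → K) (T : ℕ)
    (h0 : c 0 = 1) (h1 : c 1 = 1) (h2 : c 2 = 1) (h3 : c 3 = S)
    (h : ∀ n ≤ T, c (n + 4) * c (n + 1) ^ N = -(c (n + 3) ^ N * c n) +
      S * c (n + 3) ^ (N - k) * c (n + 2) ^ (k * N - 1) * c (n + 1) ^ (N - k)) :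
    ∀ n ≤ T + 2, c n ≠ 0 ∧ c (n + 1) ≠ 0 ∧ c (n + 2) ≠ 0 ∧
      c (n + 2) * c n = confinedOrbit S k n * c (n + 1) ^ N := by
  intro n
  induction n using Nat.strong_induction_on with
  | _ n ih =>
    intro hn
    match n, ih, hn with
    | 0, _, _ => simp [h0, h1, h2, confinedOrbit]
    | 1, _, _ => simpa [h1, h2, h3, confinedOrbit] using hS 1
    | n + 2, ih, hn =>
      obtain ⟨ha, hb, hc, e0⟩ := ih n (by omega) (by omega)
      obtain ⟨-, -, hd, e1⟩ := ih (n + 1) (by omega) (by omega)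
      have hr := hS (n + 1)
      have hr2 := hS (n + 2)
      have e := h n (by omega)
      simp only [confinedOrbit] at hr2 ⊢
      simp only [add_assoc, Nat.reduceAdd] at *
      have hp : c (n + 2) ^ (k * N - 1) * c (n + 2) = c (n + 2) ^ (N * k) := by
        rw [← pow_succ, mul_comm N k]
        congr 1
        have := Nat.mul_pos hk (hk.trans_le hkN)
        omega
      have e1k : c (n + 3) ^ k * c (n + 1) ^ k
          = confinedOrbit S k (n + 1) ^ k * c (n + 2) ^ (N * k) := by
        rw [← mul_pow, e1, mul_pow, ← pow_mul]
      have s3 : c (n + 3) ^ N = c (n + 3) ^ (N - k) * c (n + 3) ^ k := by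
        rw [← pow_add, Nat.sub_add_cancel hkN]
      have s1 : c (n + 1) ^ N = c (n + 1) ^ (N - k) * c (n + 1) ^ k := by
        rw [← pow_add, Nat.sub_add_cancel hkN]
      have key : c (n + 4) * c (n + 2) =
          (-confinedOrbit S k n + S * (confinedOrbit S k (n + 1) ^ k)⁻¹) * c (n + 3) ^ N := by
        apply mul_right_cancel₀ (pow_ne_zero N hb)
        have hrk : confinedOrbit S k (n + 1) ^ k ≠ 0 := pow_ne_zero _ hr
        generalize confinedOrbit S k (n + 1) ^ k = R at *
        have hw : c (n + 2) ^ (N * k) = R⁻¹ * (c (n + 3) ^ k * c (n + 1) ^ k) := by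
          rw [e1k]; field_simp
        calc c (n + 4) * c (n + 2) * c (n + 1) ^ N
            = (c (n + 4) * c (n + 1) ^ N) * c (n + 2) := by ring
          _ = -(c (n + 3) ^ N * (c (n + 2) * c n)) + S * c (n + 3) ^ (N - k) *
              (c (n + 2) ^ (k * N - 1) * c (n + 2)) * c (n + 1) ^ (N - k) := by rw [e]; ring
          _ = -(c (n + 3) ^ N * (confinedOrbit S k n * c (n + 1) ^ N)) +
              S * R⁻¹ * (c (n + 3) ^ (N - k) * c (n + 3) ^ k) *
                (c (n + 1) ^ (N - k) * c (n + 1) ^ k) := by rw [e0, hp, hw]; ring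
          _ = _ := by rw [← s3, ← s1]; ring
      refine ⟨hc, hd, ?_, key⟩
      intro h4
      rw [h4, zero_mul] at key
      exact mul_ne_zero hr2 (pow_ne_zero N hd) key.symm

/-- The power series `f` agrees with `a + b X` up to first order. -/
def HasJet (f : ℚ⟦X⟧) (a b : ℚ) : Prop := coeff 0 f = a ∧ coeff 1 f = b

namespace HasJet

variable {f g : ℚ⟦X⟧} {a b c e : ℚ}

theorem add (hf : HasJet f a b) (hg : HasJet g c e) : HasJet (f + g) (a + c) (b + e) := by
  simp only [HasJet, map_add, hf.1, hf.2, hg.1, hg.2, and_self]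

theorem neg (hf : HasJet f a b) : HasJet (-f) (-a) (-b) := by
  simp only [HasJet, map_neg, hf.1, hf.2, and_self]

theorem mul (hf : HasJet f a b) (hg : HasJet g c e) :
    HasJet (f * g) (a * c) (a * e + b * c) := by
  obtain ⟨rfl, rfl⟩ := hf
  obtain ⟨rfl, rfl⟩ := hg
  refine ⟨by simp, ?_⟩
  rw [coeff_one_mul]
  simp
  ring

theorem one : HasJet 1 1 0 := by
  simp [HasJet, PowerSeries.coeff_one]

theorem one_add_X : HasJet (1 + X) 1 1 := by
  simp [HasJet, PowerSeries.coeff_one]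

theorem natCast (n : ℕ) : HasJet (n : ℚ⟦X⟧) n 0 := by
  rw [← map_natCast (C (R := ℚ)), HasJet, coeff_C, coeff_C]
  simp

theorem pow_one (hf : HasJet f 1 b) (n : ℕ) : HasJet (f ^ n) 1 (n * b) := by
  induction n with
  | zero => simpa using one
  | succ n ih =>
    rw [pow_succ]
    convert ih.mul hf using 1 <;> push_cast <;> ring

theorem pow_zero_of_two_le (hf : HasJet f 0 b) {n : ℕ} (hn : 2 ≤ n) : HasJet (f ^ n) 0 0 := by
  obtain ⟨m, rfl⟩ := Nat.exists_eq_add_of_le hn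
  rw [pow_add, pow_two]
  convert (hf.mul hf).mul (g := f ^ m) ⟨rfl, rfl⟩ using 1 <;> ring

theorem exists_inv (hf : HasJet f 1 b) : ∃ f', f * f' = 1 ∧ HasJet f' 1 (-b) := by
  have h : f * f⁻¹ = 1 := PowerSeries.mul_inv_cancel f (by
    rw [← coeff_zero_eq_constantCoeff_apply, hf.1]; exact one_ne_zero)
  have hj := hf.mul (g := f⁻¹) ⟨rfl, rfl⟩
  rw [h] at hj
  have h0 := one.1.symm.trans hj.1
  have h1 := one.2.symm.trans hj.2
  refine ⟨f⁻¹, h, by linarith, ?_⟩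
  rw [one_mul] at h0
  rw [← h0] at h1
  linarith

theorem ne_zero (hf : HasJet f 1 b) : f ≠ 0 := by
  rintro rfl
  simpa using hf.1

theorem ne_zero_of_ne_zero (hf : HasJet f a b) (hb : b ≠ 0) : f ≠ 0 := by
  rintro rfl
  exact hb (by simpa using hf.2.symm)

end HasJet

theorem orbit_confinement {K : Type*} [Field K] {i : ℚ⟦X⟧ →+* K} (hi : Function.Injective i)
    {k : ℕ} (hk : Even k) (hk0 : 0 < k) {n : ℕ} {q r : ℚ⟦X⟧} {α β : ℚ}
    (hq : HasJet q 1 α) (hr : HasJet r 0 β) (hβ : β ≠ 0)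
    (h0 : confinedOrbit (i (1 + X)) k n = i q) (h1 : confinedOrbit (i (1 + X)) k (n + 1) = i r) :
    (∀ j < 5, confinedOrbit (i (1 + X)) k (n + j) ≠ 0) ∧
      ∃ q' r' : ℚ⟦X⟧, ∃ α' : ℚ, α' = α + (if k = 2 then 2 * β else 0) ∧
        HasJet q' 1 (1 + β - k * α') ∧
        HasJet r' 0 (1 - α' - k * (1 + β - k * α')) ∧
        confinedOrbit (i (1 + X)) k (n + 5) = i q' ∧
        confinedOrbit (i (1 + X)) k (n + 6) = i r' := by
  have ne : ∀ {f : ℚ⟦X⟧}, f ≠ 0 → i f ≠ 0 := fun hf ↦ (map_ne_zero_iff i hi).2 hf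
  have hk2 : 2 ≤ k := by obtain ⟨m, rfl⟩ := hk; omega
  obtain ⟨j, hj⟩ : ∃ j, k * k = k + j + 1 :=
    ⟨k * k - k - 1, by have := Nat.mul_le_mul_right k hk2; omega⟩
  have hj1 : 1 ≤ j := by have := Nat.mul_le_mul_right k hk2; omega
  have hS := HasJet.one_add_X
  set S : ℚ⟦X⟧ := 1 + X
  have hrk := hr.pow_zero_of_two_le hk2
  obtain ⟨h, hh⟩ : ∃ h, h = S + -(q * r ^ k) := ⟨_, rfl⟩
  have jh : HasJet h 1 1 := by
    rw [hh]; convert hS.add (hq.mul hrk).neg using 1 <;> ring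
  obtain ⟨h', hh', jh'⟩ := jh.exists_inv
  obtain ⟨τ, hτ⟩ : ∃ τ, τ = S * r ^ (k + j) * h' ^ k := ⟨_, rfl⟩
  have jτ : HasJet τ 0 0 := by
    rw [hτ]
    convert (hS.mul (hr.pow_zero_of_two_le (n := k + j) (by omega))).mul (jh'.pow_one k) using 1
      <;> ring
  obtain ⟨g, hg⟩ : ∃ g, g = 1 + -τ := ⟨_, rfl⟩
  have jg : HasJet g 1 0 := by
    rw [hg]; convert HasJet.one.add jτ.neg using 1 <;> ring
  obtain ⟨g', hg', jg'⟩ := jg.exists_inv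
  obtain ⟨z, hz⟩ := Polynomial.powAddExpansion 1 (τ * g') k
  have hg1 : 1 + τ * g' = g' := by
    have : g' = g * g' + τ * g' := by rw [hg]; ring
    rw [hg'] at this; exact this.symm
  rw [hg1, one_pow, one_pow, mul_one] at hz
  obtain ⟨ρ, hρ⟩ : ∃ ρ, ρ = S * r ^ j * h' ^ k * g' := ⟨_, rfl⟩
  have hτρ : τ * g' = r ^ k * ρ := by rw [hτ, hρ, pow_add]; ring
  have jρ : HasJet ρ 0 (if k = 2 then β else 0) := by
    have jr : HasJet (r ^ j) 0 (if k = 2 then β else 0) := by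
      split_ifs with hk'
      · subst hk'
        obtain rfl : j = 1 := by omega
        simpa using hr
      · have : 3 ≤ k := by omega
        exact hr.pow_zero_of_two_le (by have := Nat.mul_le_mul_right k this; omega)
    rw [hρ]
    convert ((hS.mul jr).mul (jh'.pow_one k)).mul jg' using 1 <;> ring
  obtain ⟨p, hp⟩ : ∃ p, p = q + S * ρ * (k + z * (τ * g')) := ⟨_, rfl⟩
  obtain ⟨α', hα'⟩ : ∃ α', α' = α + (if k = 2 then 2 * β else 0) := ⟨_, rfl⟩
  have jp : HasJet p 1 α' := by
    have jz := ((HasJet.natCast k).add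
      (HasJet.mul (f := z) ⟨rfl, rfl⟩ (jτ.mul jg')))
    rw [hp, hα']
    convert hq.add ((hS.mul jρ).mul jz) using 1
    · ring
    · split_ifs with hk'
      · subst hk'; push_cast; ring
      · ring
  obtain ⟨p', hp', jp'⟩ := jp.exists_inv
  obtain ⟨m, hm⟩ : ∃ m, m = r * g + S * p' ^ k := ⟨_, rfl⟩
  have jm : HasJet m 1 (1 + β - k * α') := by
    rw [hm]
    convert (hr.mul jg).add (hS.mul (jp'.pow_one k)) using 1 <;> ring
  obtain ⟨m', hm', jm'⟩ := jm.exists_inv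
  have jr' : HasJet (-p + S * m' ^ k) 0 (1 - α' - k * (1 + β - k * α')) := by
    convert jp.neg.add (hS.mul (jm'.pow_one k)) using 1 <;> ring
  have inv : ∀ {a b : ℚ⟦X⟧}, a * b = 1 → i b = (i a)⁻¹ := fun hab ↦
    eq_inv_of_mul_eq_one_right (by rw [← map_mul, hab, map_one])
  have nr := ne (hr.ne_zero_of_ne_zero hβ)
  have nh := ne jh.ne_zero
  have ng := ne jg.ne_zero
  have nrk := pow_ne_zero k nr
  have o2 : confinedOrbit (i S) k (n + 2) = i h / i r ^ k := by
    rw [confinedOrbit, h0, h1, hh]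
    simp only [map_add, map_neg, map_mul, map_pow]
    field_simp
    ring
  have o3 : confinedOrbit (i S) k (n + 3) = -(i r * i g) := by
    rw [confinedOrbit, h1, o2, hg, hτ]
    simp only [map_add, map_neg, map_mul, map_pow, map_one, inv hh', inv_pow]
    rw [div_pow, ← pow_mul, hj, pow_succ]
    have nhk := pow_ne_zero k nh
    field_simp
    ring
  have o4 : confinedOrbit (i S) k (n + 4) = i p := by
    have hz' : (i g ^ k)⁻¹ = i (1 + k * (τ * g') + z * (τ * g') ^ 2) := by
      rw [← hz, map_pow, inv hg', inv_pow]
    rw [confinedOrbit, o2, o3, hk.neg_pow, mul_pow, mul_inv, hz', hτρ, hp, hτρ, hh]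
    simp only [map_add, map_neg, map_mul, map_pow, map_one]
    field_simp
    ring
  have o5 : confinedOrbit (i S) k (n + 5) = i m := by
    rw [confinedOrbit, o3, o4, hm]
    simp only [map_add, map_mul, map_pow, inv hp', inv_pow, neg_neg]
  have o6 : confinedOrbit (i S) k (n + 6) = i (-p + S * m' ^ k) := by
    rw [confinedOrbit, o4, o5]
    simp only [map_add, map_neg, map_mul, map_pow, inv hm', inv_pow]
  refine ⟨fun t ht ↦ ?_, m, _, α', hα', jm, jr', o5, o6⟩
  interval_cases t
  · rw [add_zero, h0]; exact ne hq.ne_zero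
  · rw [h1]; exact nr
  · rw [o2]; exact div_ne_zero nh nrk
  · rw [o3]; exact neg_ne_zero.2 (mul_ne_zero nr ng)
  · rw [o4]; exact ne jp.ne_zero

theorem confinedOrbit_ne_zero {K : Type*} [Field K] {i : ℚ⟦X⟧ →+* K}
    (hi : Function.Injective i) {k : ℕ} (hk : Even k) (hk0 : 0 < k) (n : ℕ) :
    confinedOrbit (i (1 + X)) k n ≠ 0 := by
  have hk2 : 2 ≤ k := by obtain ⟨m, rfl⟩ := hk; omega
  have main : ∀ t : ℕ, ∃ q r : ℚ⟦X⟧, ∃ α β : ℚ, HasJet q 1 α ∧ HasJet r 0 β ∧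
      confinedOrbit (i (1 + X)) k (1 + 5 * t) = i q ∧
      confinedOrbit (i (1 + X)) k (1 + 5 * t + 1) = i r ∧ β ≠ 0 ∧
      (if k = 2 then 1 ≤ α ∧ β = -α else (1 ≤ α ∧ β ≤ -1) ∨ (α ≤ -1 ∧ 1 ≤ β)) := by
    intro t
    induction t with
    | zero =>
      obtain ⟨S', hS', jS'⟩ := HasJet.one_add_X.exists_inv
      refine ⟨1 + X, -1 + (1 + X) * S' ^ k, 1, 1 - k, HasJet.one_add_X, ?_, ?_, ?_, ?_, ?_⟩
      · convert HasJet.one.neg.add (HasJet.one_add_X.mul (jS'.pow_one k)) using 1 <;> ring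
      · simp [confinedOrbit]
      · have : i S' = (i (1 + X))⁻¹ :=
          eq_inv_of_mul_eq_one_right (by rw [← map_mul, hS', map_one])
        show confinedOrbit (i (1 + X)) k 2 = _
        rw [map_add i (-1), map_neg, map_mul, map_pow, this, map_one]
        simp only [confinedOrbit, inv_pow]
      · have : (2 : ℚ) ≤ k := by exact_mod_cast hk2
        linarith
      · have : (2 : ℚ) ≤ k := by exact_mod_cast hk2
        split_ifs with h
        · subst h; norm_num
        · left; constructor <;> linarith
    | succ t ih =>
      obtain ⟨q, r, α, β, hq, hr, h0, h1, hβ, hαβ⟩ := ih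
      obtain ⟨-, q', r', α', hα', jq, jr, o5, o6⟩ := orbit_confinement hi hk hk0 hq hr hβ h0 h1
      have hinv : (if k = 2 then 1 ≤ 1 + β - k * α' ∧
          1 - α' - k * (1 + β - k * α') = -(1 + β - k * α') else
          (1 ≤ 1 + β - k * α' ∧ 1 - α' - k * (1 + β - k * α') ≤ -1) ∨
          (1 + β - k * α' ≤ -1 ∧ 1 ≤ 1 - α' - k * (1 + β - k * α'))) := by
        split_ifs at hα' hαβ ⊢ with h
        · obtain ⟨ha, rfl⟩ := hαβ
          subst h hα'
          push_cast
          constructor <;> linarith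
        · have hk3 : (3 : ℚ) ≤ k := by exact_mod_cast (show 3 ≤ k by omega)
          rw [add_zero] at hα'
          subst hα'
          have hkk : (0 : ℚ) ≤ k * k - 9 := by nlinarith
          rcases hαβ with ⟨ha, hb⟩ | ⟨ha, hb⟩
          · refine Or.inr ⟨by nlinarith, ?_⟩
            nlinarith [mul_nonneg hkk (sub_nonneg.2 ha)]
          · refine Or.inl ⟨by nlinarith, ?_⟩
            nlinarith [mul_nonneg hkk (sub_nonneg.2 ha)]
      refine ⟨q', r', _, _, jq, jr, o5, o6, ?_, hinv⟩
      intro hz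
      rw [hz] at hinv
      split_ifs at hinv
      · linarith [hinv.1, hinv.2]
      · rcases hinv with h | h <;> linarith [h.1, h.2]
  rcases n with _ | n
  · simp [confinedOrbit]
  · obtain ⟨q, r, α, β, hq, hr, h0, h1, hβ, -⟩ := main (n / 5)
    have := (orbit_confinement hi hk hk0 hq hr hβ h0 h1).1 (n % 5) (Nat.mod_lt _ (by norm_num))
    convert this using 2
    omega

end Confinement

/-- Evaluation at `x = 0`, `a_{i₀} = 1 + X` and all other parameters zero. -/
noncomputable def specializeHom {d : ℕ} (i₀ : Fin d) : SpecPoly d →+* PowerSeries ℚ :=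
  (MvPolynomial.eval₂Hom (Int.castRingHom (PowerSeries ℚ))
    (Sum.elim (fun i ↦ if i = i₀ then 1 + PowerSeries.X else 0) fun _ ↦ 0)).comp
      Polynomial.constantCoeff

theorem specialize_inl {d : ℕ} (i₀ i : Fin d) :
    specializeHom i₀ (Polynomial.C (MvPolynomial.X (Sum.inl i))) =
      if i = i₀ then 1 + PowerSeries.X else 0 := by
  simp [specializeHom]

theorem specialize_inr {d : ℕ} (i₀ i : Fin d) :
    specializeHom i₀ (Polynomial.C (MvPolynomial.X (Sum.inr i))) = 0 := by
  simp [specializeHom]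

theorem specialize_X {d : ℕ} (i₀ : Fin d) : specializeHom i₀ Polynomial.X = 0 := by
  simp [specializeHom]

theorem coeff_zero_ne_zero_of_specializeHom {d : ℕ} {i₀ : Fin d} {p : SpecPoly d}
    (h : specializeHom i₀ p ≠ 0) : p.coeff 0 ≠ 0 := by
  intro hp
  apply h
  simp only [specializeHom, RingHom.comp_apply, Polynomial.constantCoeff_apply, hp, map_zero]

theorem tau_relation_of_div {A F ι : Type*} [CommRing A] [IsDomain A] [Field F] [Fintype ι]
    {f : A →+* F} (hf : Function.Injective f) {N : ℕ} {k l : ι → ℕ} (hkN : ∀ i, k i ≤ N)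
    (hlN : ∀ i, l i ≤ N) {a b : ι → A} {z p w v u : A} (hv : v ≠ 0)
    (h : f z = -((f p) ^ N * f u) / (f v) ^ N +
      ∑ i, (f (a i) * (f p) ^ (N - k i) * (f w) ^ (k i * N - 1) / (f v) ^ (k i) +
        f (b i) * (f p) ^ (N - l i) * (f w) ^ (l i * N - 1) / (f v) ^ (l i))) :
    z * v ^ N = -(p ^ N * u) +
      ∑ i, (a i * p ^ (N - k i) * w ^ (k i * N - 1) * v ^ (N - k i) +
        b i * p ^ (N - l i) * w ^ (l i * N - 1) * v ^ (N - l i)) := by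
  have hv' : f v ≠ 0 := (map_ne_zero_iff f hf).2 hv
  have term : ∀ (c : F) (m : ℕ), m ≤ N → c / f v ^ m * f v ^ N = c * f v ^ (N - m) := by
    intro c m hm
    rw [div_mul_eq_mul_div, div_eq_iff (pow_ne_zero _ hv'), mul_assoc, ← pow_add,
      Nat.sub_add_cancel hm]
  apply hf
  simp only [map_add, map_neg, map_mul, map_pow, map_sum]
  rw [h, add_mul, div_mul_cancel₀ _ (pow_ne_zero _ hv'), Finset.sum_mul]
  congr 1
  refine Finset.sum_congr rfl fun i _ ↦ ?_
  rw [add_mul, term _ _ (hkN i), term _ _ (hlN i)]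

/-- The specialized tau-function iterates `y_t` in `R[x]`,
`R = ℤ[a_i, b_i]`, with `y_{−4} = −x`, `y_{−3} = y_{−2} = y_{−1} = 1` and
`y_{t+1} = −y_t^N y_{t−3}/y_{t−2}^N + Σ_i (a_i y_t^{N−k_i} y_{t−1}^{k_i N−1}/y_{t−2}^{k_i}
+ b_i y_t^{N−l_i} y_{t−1}^{l_i N−1}/y_{t−2}^{l_i})` (`N = Σ_i (k_i + l_i)`, all `k_i, l_i`
positive even) satisfy `y₀ = x + Σ_i (a_i + b_i)`; and if for each `0 ≤ s ≤ t` the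
polynomial `y_s` has nonzero constant term and `y_{s−1} ∣ y_s`, the same holds at `t+1`. -/
theorem stmt10 (d : ℕ) (hd : 1 ≤ d) (k l : Fin d → ℕ)
    (hk : ∀ i, Even (k i) ∧ 0 < k i) (hl : ∀ i, Even (l i) ∧ 0 < l i)
    (N : ℕ) (hN : N = ∑ i, (k i + l i))
    (y : ℤ → SpecPoly d)
    (hy4 : y (-4) = -Polynomial.X) (hy3 : y (-3) = 1) (hy2 : y (-2) = 1)
    (hy1 : y (-1) = 1)
    (hrec : ∀ t : ℤ, -1 ≤ t →
      specMap d (y (t + 1)) =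
        -((specMap d (y t)) ^ N * specMap d (y (t - 3))) / (specMap d (y (t - 2))) ^ N +
          ∑ i, (specMap d (Polynomial.C (MvPolynomial.X (Sum.inl i))) *
                  (specMap d (y t)) ^ (N - k i) * (specMap d (y (t - 1))) ^ (k i * N - 1) /
                  (specMap d (y (t - 2))) ^ (k i) +
                specMap d (Polynomial.C (MvPolynomial.X (Sum.inr i))) *
                  (specMap d (y t)) ^ (N - l i) * (specMap d (y (t - 1))) ^ (l i * N - 1) /
                  (specMap d (y (t - 2))) ^ (l i))) :
    y 0 = Polynomial.X +
        Polynomial.C (∑ i, (MvPolynomial.X (Sum.inl i) + MvPolynomial.X (Sum.inr i))) ∧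
      ∀ t : ℤ, 0 ≤ t →
        (∀ s : ℤ, 0 ≤ s → s ≤ t → (y s).coeff 0 ≠ 0 ∧ y (s - 1) ∣ y s) →
        (y (t + 1)).coeff 0 ≠ 0 ∧ y t ∣ y (t + 1) := by
  have hinj : Function.Injective (specMap d) := IsFractionRing.injective _ _
  have hkN : ∀ i, k i + 2 ≤ N := by
    intro i
    have := Finset.single_le_sum (f := fun i ↦ k i + l i) (fun _ _ ↦ Nat.zero_le _)
      (Finset.mem_univ i)
    obtain ⟨⟨m, hm⟩, hm0⟩ := hl i
    omega
  have hlN : ∀ i, l i + 2 ≤ N := by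
    intro i
    have := Finset.single_le_sum (f := fun i ↦ k i + l i) (fun _ _ ↦ Nat.zero_le _)
      (Finset.mem_univ i)
    obtain ⟨⟨m, hm⟩, hm0⟩ := hk i
    omega
  obtain ⟨i₀⟩ : Nonempty (Fin d) := ⟨⟨0, hd⟩⟩
  have hN4 : 4 ≤ N := by
    obtain ⟨⟨m, hm⟩, hm0⟩ := hk i₀
    have := hkN i₀
    omega
  have rel : ∀ t : ℤ, -1 ≤ t → y (t - 2) ≠ 0 → _ := fun t ht hne ↦
    tau_relation_of_div hinj (fun i ↦ (Nat.le_add_right _ 2).trans (hkN i))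
      (fun i ↦ (Nat.le_add_right _ 2).trans (hlN i)) hne (hrec t ht)
  have hy0 : y 0 = Polynomial.X +
      Polynomial.C (∑ i, (MvPolynomial.X (Sum.inl i) + MvPolynomial.X (Sum.inr i))) := by
    have h := rel (-1) le_rfl (by norm_num [hy3])
    norm_num [hy1, hy2, hy3, hy4] at h
    rw [h]
    simp only [map_sum, map_add]
  refine ⟨hy0, fun t ht hs ↦ ?_⟩
  obtain ⟨T, rfl⟩ := Int.eq_ofNat_of_zero_le ht
  have hne : ∀ n ≤ T + 3, y ((n : ℤ) - 3) ≠ 0 := by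
    intro n hn
    rcases lt_or_ge n 3 with h | h
    · interval_cases n <;> norm_num [hy1, hy2, hy3]
    · intro h0
      refine (hs ((n : ℤ) - 3) (by omega) (by omega)).1 ?_
      rw [h0, Polynomial.coeff_zero]
  have rel' : ∀ n ≤ T, _ := fun (n : ℕ) hn ↦ rel n (by omega) (by
    have := hne (n + 1) (by omega)
    convert this using 2
    push_cast
    ring)
  constructor
  · set f := (algebraMap (PowerSeries ℚ) (FractionRing (PowerSeries ℚ))).comp (specializeHom i₀)
      with hf
    have hi := IsFractionRing.injective (PowerSeries ℚ) (FractionRing (PowerSeries ℚ))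
    have horb := confinedOrbit_ne_zero hi (hk i₀).1 (hk i₀).2
    have main := tau_mul_eq_orbit (hk i₀).2 ((Nat.le_add_right _ 2).trans (hkN i₀)) horb
      (fun n ↦ f (y ((n : ℤ) - 3))) T (by norm_num [hy3]) (by norm_num [hy2])
      (by norm_num [hy1]) ?_ ?_ (T + 2) le_rfl
    · have h := main.2.2.1
      have e : ((T + 2 + 2 : ℕ) : ℤ) - 3 = T + 1 := by push_cast; ring
      simp only [e] at h
      refine coeff_zero_ne_zero_of_specializeHom (i₀ := i₀) fun h0 ↦ h ?_
      rw [hf, RingHom.comp_apply, h0, map_zero]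
    · norm_num [hy0, hf, -map_sum]
      rw [map_sum, map_sum]
      simp [specialize_X, specialize_inl, specialize_inr]
    · intro n hn
      have h := congrArg f (rel' n hn)
      have e4 : ((n + 4 : ℕ) : ℤ) - 3 = n + 1 := by push_cast; ring
      have e3 : ((n + 3 : ℕ) : ℤ) - 3 = n := by push_cast; ring
      have e2 : ((n + 2 : ℕ) : ℤ) - 3 = n - 1 := by push_cast; ring
      have e1 : ((n + 1 : ℕ) : ℤ) - 3 = n - 2 := by push_cast; ring
      simp only [e4, e3, e2, e1]
      simp only [map_add, map_neg, map_mul, map_pow, map_sum] at h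
      rw [h]
      congr 1
      rw [Finset.sum_eq_single i₀]
      · simp [hf, specialize_inl, specialize_inr]
      · intro i _ hi₀
        simp [hf, specialize_inl, specialize_inr, hi₀]
      · simp
  · have main : ∀ n ≤ T + 3, y ((n : ℤ) - 3) ^ 2 ∣ y ((n : ℤ) - 2) := by
      intro n
      induction n using Nat.strong_induction_on with
      | _ n ih =>
        intro hn
        rcases lt_or_ge n 3 with h | h
        · interval_cases n <;> norm_num [hy1, hy2, hy3]
        · obtain ⟨n, rfl⟩ := Nat.exists_eq_add_of_le' h
          have h1 := ih (n + 1) (by omega) (by omega)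
          have h2 := ih (n + 2) (by omega) (by omega)
          have h3 := hne (n + 1) (by omega)
          have e5 : ((n + 3 : ℕ) : ℤ) - 2 = n + 1 := by push_cast; ring
          have e4 : ((n + 3 : ℕ) : ℤ) - 3 = n := by push_cast; ring
          have e3 : ((n + 2 : ℕ) : ℤ) - 2 = n := by push_cast; ring
          have e2 : ((n + 2 : ℕ) : ℤ) - 3 = n - 1 := by push_cast; ring
          have e1 : ((n + 1 : ℕ) : ℤ) - 2 = n - 1 := by push_cast; ring
          have e0 : ((n + 1 : ℕ) : ℤ) - 3 = n - 2 := by push_cast; ring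
          rw [e0] at h3
          rw [e0, e1] at h1
          rw [e2, e3] at h2
          rw [e4, e5]
          exact sq_dvd_of_tau_relation hN4 k l (fun i ↦ (hk i).2) (fun i ↦ (hl i).2) hkN hlN
            _ _ h3 h1 h2 (rel' n (by omega))
    have h := main (T + 3) le_rfl
    have e5 : ((T + 3 : ℕ) : ℤ) - 2 = T + 1 := by push_cast; ring
    have e4 : ((T + 3 : ℕ) : ℤ) - 3 = T := by push_cast; ring
    rw [e4, e5] at h
    exact (dvd_pow_self _ two_ne_zero).trans h
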